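/- Let t ≥ 3 and let G be a connected (P5,dart)-free finite simple graph containing an induced copy C of the complement of the (2t+1)-cycle, with vertices v1,...,v_{2t+1} such that v_i and v_j are adjacent if and only if their circular distance modulo 2t+1 is greater than 1. Then every vertex of G not on C has at least one neighbor on C; that is, S_0 = ∅. -/

import Mathlib

open SimpleGraph

/-- `G` contains an induced subgraph isomorphic to `H`. -/
def ContainsInduced {V : Type*} {W : Type*} (G : SimpleGraph V) (H : SimpleGraph W) : Prop :=
  ∃ f : W ↪ V, ∀ a b, H.Adj a b ↔ G.Adj (f a) (f b)

/-- The path on 5 vertices. -/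
def P5 : SimpleGraph (Fin 5) := SimpleGraph.pathGraph 5

/-- The dart: vertices `0,1,2,3,4` and edges `01, 12, 23, 30, 02, 24`. -/
def dart : SimpleGraph (Fin 5) :=
  SimpleGraph.fromRel (fun a b =>
    (a, b) = (0, 1) ∨ (a, b) = (1, 2) ∨ (a, b) = (2, 3) ∨
    (a, b) = (3, 0) ∨ (a, b) = (0, 2) ∨ (a, b) = (2, 4))

/-- `G` is `k`-vertex-critical: `χ(G) = k` and `χ(G - v) < k` for every vertex `v`. -/
def IsVertexCritical {V : Type*} (G : SimpleGraph V) (k : ℕ) : Prop :=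
  G.chromaticNumber = k ∧
  ∀ v : V, (G.induce {u | u ≠ v}).chromaticNumber < k

theorem containsInduced_P5 {V : Type*} {G : SimpleGraph V} {a b c d e : V}
    (hab : G.Adj a b) (hbc : G.Adj b c) (hcd : G.Adj c d) (hde : G.Adj d e)
    (hac : ¬ G.Adj a c) (had : ¬ G.Adj a d) (hae : ¬ G.Adj a e)
    (hbd : ¬ G.Adj b d) (hbe : ¬ G.Adj b e) (hce : ¬ G.Adj c e) :
    ContainsInduced G P5 := by
  have key : ∀ x y, P5.Adj x y ↔ G.Adj (![a, b, c, d, e] x) (![a, b, c, d, e] y) := by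
    intro x y
    fin_cases x <;> fin_cases y <;>
      simp [P5, SimpleGraph.pathGraph_adj, G.adj_comm, *]
  refine ⟨⟨![a, b, c, d, e], fun x y hxy => ?_⟩, key⟩
  have twin : ∀ z, P5.Adj x z ↔ P5.Adj y z := fun z => by rw [key, key, hxy]
  have h0 := twin 0
  have h1 := twin 1
  have h2 := twin 2
  have h3 := twin 3
  have h4 := twin 4
  fin_cases x <;> fin_cases y <;> simp [P5, SimpleGraph.pathGraph_adj] at h0 h1 h2 h3 h4 ⊢

theorem containsInduced_dart {V : Type*} {G : SimpleGraph V} {a b c d e : V}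
    (hab : G.Adj a b) (hbc : G.Adj b c) (hcd : G.Adj c d) (hda : G.Adj d a)
    (hac : G.Adj a c) (hce : G.Adj c e) (hne : b ≠ d)
    (hbd : ¬ G.Adj b d) (hae : ¬ G.Adj a e) (hbe : ¬ G.Adj b e) (hde : ¬ G.Adj d e) :
    ContainsInduced G dart := by
  have key : ∀ x y, dart.Adj x y ↔ G.Adj (![a, b, c, d, e] x) (![a, b, c, d, e] y) := by
    intro x y
    fin_cases x <;> fin_cases y <;>
      simp [dart, G.adj_comm, hda.symm, *]
  refine ⟨⟨![a, b, c, d, e], fun x y hxy => ?_⟩, key⟩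
  have twin : ∀ z, dart.Adj x z ↔ dart.Adj y z := fun z => by rw [key, key, hxy]
  have h0 := twin 0
  have h1 := twin 1
  have h2 := twin 2
  have h3 := twin 3
  have h4 := twin 4
  fin_cases x <;> fin_cases y <;> simp [dart] at h0 h1 h2 h3 h4 ⊢ <;> simp_all

/-- In a connected graph, a property that holds somewhere and fails somewhere changes along
an edge. -/
theorem SimpleGraph.Connected.exists_adj_of_not {V : Type*} {G : SimpleGraph V}
    (hG : G.Connected) {p : V → Prop} {a b : V} (ha : p a) (hb : ¬ p b) :
    ∃ x y, G.Adj x y ∧ p x ∧ ¬ p y := by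
  obtain ⟨w⟩ := hG.preconnected a b
  obtain ⟨d, -, h1, h2⟩ := w.exists_boundary_dart {x | p x} ha hb
  exact ⟨_, _, d.adj, h1, h2⟩

open scoped Fin.CommRing in
theorem antihole_adj {V : Type*} {G : SimpleGraph V} {n : ℕ} [NeZero n] {v : Fin n → V}
    (hC : ∀ i j, G.Adj (v i) (v j) ↔ (i ≠ j ∧ j ≠ i + 1 ∧ i ≠ j + 1))
    (i : Fin n) {k : ℕ} (hk : 2 ≤ k) (hkn : k + 1 < n) : G.Adj (v i) (v (i + k)) := by
  have hz : ∀ m : ℕ, 0 < m → m < n → (m : Fin n) ≠ 0 := fun m h0 hm h =>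
    absurd (Nat.le_of_dvd h0 (Fin.natCast_eq_zero.mp h)) (by omega)
  refine (hC _ _).mpr ⟨fun h => hz k (by omega) (by omega) ?_, fun h => ?_, fun h => ?_⟩
  · simpa using h.symm
  · obtain ⟨m, rfl⟩ := Nat.exists_eq_add_of_le' hk
    refine hz (m + 1) (by omega) (by omega) ?_
    have h' := add_left_cancel h
    rw [show ((m + 2 : ℕ) : Fin n) = ((m + 1 : ℕ) : Fin n) + 1 by
      push_cast; rw [add_assoc, one_add_one_eq_two]] at h'
    simpa using h'
  · refine hz (k + 1) (by omega) (by omega) ?_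
    rw [add_assoc] at h
    simpa using h.symm

open scoped Fin.CommRing in
/-- If `w` has a neighbour `s` that is anticomplete to the antihole, then `w` is itself
anticomplete to the antihole. -/
theorem antihole_not_adj_of_adj {V : Type*} {G : SimpleGraph V} (hP5 : ¬ ContainsInduced G P5)
    (hdart : ¬ ContainsInduced G dart) {n : ℕ} [NeZero n] (hn : 6 < n) {v : Fin n → V}
    (hinj : Function.Injective v)
    (hC : ∀ i j, G.Adj (v i) (v j) ↔ (i ≠ j ∧ j ≠ i + 1 ∧ i ≠ j + 1))
    {s w : V} (hsw : G.Adj s w) (hs : ∀ i, ¬ G.Adj s (v i)) (i : Fin n) :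
    ¬ G.Adj w (v i) := by
  have hcons : ∀ i, ¬ G.Adj (v i) (v (i + 1)) := fun i h => ((hC _ _).mp h).2.1 rfl
  have no_triple : ∀ i, G.Adj w (v i) → G.Adj w (v (i + (3 : ℕ))) →
      G.Adj w (v (i + (4 : ℕ))) → False := by
    intro i h0 h3 h4
    have e : i + ((4 : ℕ) : Fin n) = i + ((3 : ℕ) : Fin n) + 1 := by
      rw [add_assoc]; congr 1; norm_cast
    have h03 := antihole_adj hC i (k := 3) (by omega) (by omega)
    have h04 := antihole_adj hC i (k := 4) (by omega) (by omega)
    refine hdart (containsInduced_dart h03 h3.symm h4 h04.symm h0.symm hsw.symm ?_ ?_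
      (fun h => hs _ h.symm) (fun h => hs _ h.symm) (fun h => hs _ h.symm))
    · intro h
      rw [e] at h
      have h1 : (1 : Fin n) = 0 := by simpa using (hinj h).symm
      rw [← Nat.cast_one, Fin.natCast_eq_zero, Nat.dvd_one] at h1
      omega
    · rw [e]; exact hcons _
  have forced : ∀ i, G.Adj w (v i) → ¬ G.Adj w (v (i + 1)) → ∀ k : ℕ, 3 ≤ k → k + 1 < n →
      G.Adj w (v (i + k)) := by
    intro i h0 h1 k hk hkn
    by_contra hwk
    have hk1 : i + (k : Fin n) = i + 1 + ((k - 1 : ℕ) : Fin n) := by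
      obtain ⟨m, rfl⟩ := Nat.exists_eq_add_of_le' (show 1 ≤ k by omega)
      simp only [Nat.add_sub_cancel]
      push_cast
      rw [add_assoc, add_comm (1 : Fin n)]
    have hadj := antihole_adj hC (i + 1) (k := k - 1) (by omega) (by omega)
    rw [← hk1] at hadj
    exact hP5 (containsInduced_P5 hsw h0 (antihole_adj hC i (by omega) hkn) hadj.symm
      (hs _) (hs _) (hs _) hwk h1 (hcons i))
  intro hi
  by_cases hstep : ∀ j, G.Adj w (v j) → G.Adj w (v (j + 1))
  · have hall : ∀ k : ℕ, G.Adj w (v (i + k)) := by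
      intro k
      induction k with
      | zero => simpa using hi
      | succ k ih => simpa [add_assoc] using hstep _ ih
    exact no_triple i hi (hall 3) (hall 4)
  · push Not at hstep
    obtain ⟨j, hj, hj1⟩ := hstep
    exact no_triple j hj (forced j hj hj1 3 (by omega) (by omega))
      (forced j hj hj1 4 (by omega) (by omega))

theorem antihole_S0_empty {V : Type} [Fintype V] (G : SimpleGraph V)
    (hconn : G.Connected)
    (hP5 : ¬ ContainsInduced G P5) (hdart : ¬ ContainsInduced G dart)
    (t : ℕ) (ht : 3 ≤ t) (v : Fin (2 * t + 1) → V) (hinj : Function.Injective v)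
    (hC : ∀ i j, G.Adj (v i) (v j) ↔ (i ≠ j ∧ j ≠ i + 1 ∧ i ≠ j + 1)) :
    ∀ u, u ∉ Set.range v → ∃ i, G.Adj u (v i) := by
  intro u _
  by_contra hu
  have h0 : ∃ i, G.Adj (v 0) (v i) :=
    ⟨_, antihole_adj hC 0 (k := 3) (by omega) (by omega)⟩
  obtain ⟨w, s, hws, ⟨i, hi⟩, hs⟩ :=
    hconn.exists_adj_of_not (p := fun x => ∃ i, G.Adj x (v i)) h0 hu
  exact antihole_not_adj_of_adj hP5 hdart (by omega) hinj hC hws.symm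
    (fun j hj => hs ⟨j, hj⟩) i hi
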